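/- There exist a real constant a > 0 and a real x₀ > 0 such that for every real x ≥ x₀, the number of distinct non-trivial Ramsey numbers in [0,x] satisfies r(x) ≥ a·√(x·ln x). -/

import Mathlib

open SimpleGraph Finset Real

/-- `ramsey k n` is the least positive integer `N` such that every red/blue coloring of the
edges of the complete graph on `N` vertices (encoded as a simple graph `G` on `Fin N`,
with red edges the edges of `G` and blue edges those of `Gᶜ`) contains a red clique on
`k` vertices or a blue clique on `n` vertices. -/
noncomputable def ramsey (k n : ℕ) : ℕ :=
  sInf {N : ℕ | 0 < N ∧ ∀ G : SimpleGraph (Fin N),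
    (∃ s : Finset (Fin N), G.IsNClique k s) ∨ (∃ s : Finset (Fin N), Gᶜ.IsNClique n s)}

/-- The set `R(x)` of non-trivial Ramsey numbers at most `x`. -/
def RamseySet (x : ℝ) : Set ℕ :=
  {m : ℕ | (∃ k n : ℕ, 3 ≤ k ∧ k ≤ n ∧ ramsey k n = m) ∧ (m : ℝ) ≤ x}

/-- `r(x)`: the number of distinct non-trivial Ramsey numbers in `[0, x]`. -/
noncomputable def ramseyCount (x : ℝ) : ℕ := (RamseySet x).ncard

/-- The set `R_k(x) = {r(k,n) : n ≥ k} ∩ [0,x]`. -/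
def RamseySetRow (k : ℕ) (x : ℝ) : Set ℕ :=
  {m : ℕ | (∃ n : ℕ, k ≤ n ∧ ramsey k n = m) ∧ (m : ℝ) ≤ x}

/-- `r_k(x)`: the number of distinct values `r(k,n)` (`n ≥ k`) in `[0, x]`. -/
noncomputable def ramseyCountRow (k : ℕ) (x : ℝ) : ℕ := (RamseySetRow k x).ncard

theorem two_mul_sum_powerset_card {α : Type*} [DecidableEq α] (s : Finset α) :
    2 * ∑ t ∈ s.powerset, #t = #s * 2 ^ #s := by
  have h : ∑ t ∈ s.powerset, #t = ∑ t ∈ s.powerset, #(s \ t) := by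
    refine Finset.sum_nbij' (fun t ↦ s \ t) (fun t ↦ s \ t) ?_ ?_ ?_ ?_ ?_
    · intro t _; simp
    · intro t _; simp
    · intro t ht; simpa using Finset.mem_powerset.1 ht
    · intro t ht; simpa using Finset.mem_powerset.1 ht
    · intro t ht; simp [Finset.inter_eq_right.2 (Finset.mem_powerset.1 ht)]
  rw [two_mul]
  nth_rewrite 2 [h]
  rw [← Finset.sum_add_distrib, Finset.sum_congr rfl (g := fun _ ↦ #s)]
  · simp [mul_comm]
  · intro t ht
    have := Finset.card_sdiff_add_card_eq_card (Finset.mem_powerset.1 ht)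
    omega

theorem mul_two_pow_add_one_le {L d x : ℕ} (hd : L * (16 ^ L + 1) ≤ d) :
    2 * (L * (2 ^ x + 1)) ≤ 2 * d + x * 2 ^ x := by
  have h1 : 1 ≤ 2 ^ x := Nat.one_le_two_pow
  rcases le_total (4 * L) x with h | h
  · nlinarith [Nat.mul_le_mul_right (2 ^ x) h, Nat.mul_le_mul_left L h1]
  · have h2 : 2 ^ x ≤ 16 ^ L := by
      calc 2 ^ x ≤ 2 ^ (4 * L) := Nat.pow_le_pow_right (by norm_num) h
        _ = 16 ^ L := by rw [pow_mul]; norm_num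
    nlinarith [Nat.mul_le_mul_left L h2]

section IndepSets

variable {V : Type*} [Fintype V] [DecidableEq V] (G : SimpleGraph V) [DecidableRel G.Adj]

/-- The independent sets of a finite graph. -/
def indepSets : Finset (Finset V) := {W | G.IsIndepSet (W : Set V)}

variable {G}

theorem mem_indepSets {W : Finset V} :
    W ∈ indepSets G ↔ ∀ a ∈ W, ∀ b ∈ W, ¬ G.Adj a b := by
  simp only [indepSets, Finset.mem_filter, Finset.mem_univ, true_and, isIndepSet_iff]
  refine ⟨fun h a ha b hb hab ↦ h ha hb hab.ne hab, fun h a ha b hb _ ↦ h a ha b hb⟩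

/-- The independent sets that agree with `H` outside the closed neighbourhood of `v`. -/
theorem filter_indepSets_sdiff_eq (hG : G.CliqueFree 3) (v : V) {H : Finset V}
    (hH : H ∈ indepSets G) (hHv : Disjoint H (insert v (G.neighborFinset v))) :
    {W ∈ indepSets G | W \ insert v (G.neighborFinset v) = H} =
      insert (insert v H)
        (({u ∈ G.neighborFinset v | ∀ w ∈ H, ¬ G.Adj u w} : Finset V).powerset.image
          (H ∪ ·)) := by
  rw [mem_indepSets] at hH
  rw [Finset.disjoint_left] at hHv
  simp only [Finset.mem_insert, mem_neighborFinset, not_or] at hHv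
  have hN : ∀ a b, G.Adj v a → G.Adj v b → ¬ G.Adj a b := fun a b ha hb hab ↦
    G.isIndepSet_neighborSet_of_triangleFree hG v ha hb hab.ne hab
  ext W
  simp only [Finset.mem_filter, Finset.mem_insert, Finset.mem_image, Finset.mem_powerset,
    mem_indepSets]
  constructor
  · rintro ⟨hW, rfl⟩
    by_cases hv : v ∈ W
    · left
      ext u
      simp only [Finset.mem_insert, Finset.mem_sdiff, mem_neighborFinset]
      have := hW v hv u
      grind
    · right
      refine ⟨W ∩ G.neighborFinset v, ?_, ?_⟩
      · intro u
        simp only [Finset.mem_inter, Finset.mem_filter, Finset.mem_sdiff]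
        exact fun hu ↦ ⟨hu.2, fun w hw ↦ hW u hu.1 w hw.1⟩
      · ext u
        simp only [Finset.mem_union, Finset.mem_inter, Finset.mem_sdiff, Finset.mem_insert]
        grind
  · rintro (rfl | ⟨S, hS, rfl⟩)
    · refine ⟨fun a ha b hb hab ↦ ?_, ?_⟩
      · have := hab.symm
        have := hab.ne
        grind
      · ext u
        simp only [Finset.mem_insert, Finset.mem_sdiff, mem_neighborFinset]
        grind
    · have hS' : ∀ u ∈ S, G.Adj v u ∧ ∀ w ∈ H, ¬ G.Adj u w := fun u hu ↦ by
        simpa using hS hu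
      refine ⟨fun a ha b hb hab ↦ ?_, ?_⟩
      · have := hab.symm
        grind
      · ext u
        simp only [Finset.mem_insert, Finset.mem_sdiff, mem_neighborFinset, Finset.mem_union]
        grind

theorem card_filter_mul_le_sum_filter (hG : G.CliqueFree 3) {L d : ℕ}
    (hd : L * (16 ^ L + 1) ≤ d) (v : V) {H : Finset V}
    (hH : H ∈ indepSets G) (hHv : Disjoint H (insert v (G.neighborFinset v))) :
    #{W ∈ indepSets G | W \ insert v (G.neighborFinset v) = H} * L ≤
      ∑ W ∈ indepSets G with W \ insert v (G.neighborFinset v) = H,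
        ((if v ∈ W then d else 0) + #(G.neighborFinset v ∩ W)) := by
  rw [filter_indepSets_sdiff_eq hG v hH hHv]
  rw [Finset.disjoint_left] at hHv
  simp only [Finset.mem_insert, mem_neighborFinset, not_or] at hHv
  set X : Finset V := {u ∈ G.neighborFinset v | ∀ w ∈ H, ¬ G.Adj u w}
  have hXN : ∀ u ∈ X, G.Adj v u := fun u hu ↦ by
    simpa using (Finset.mem_filter.1 hu).1
  have hnot : insert v H ∉ X.powerset.image (H ∪ ·) := by
    simp only [Finset.mem_image, Finset.mem_powerset, not_exists, not_and]
    intro S hS h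
    have h1 : v ∈ H ∪ S := h ▸ Finset.mem_insert_self v H
    rcases Finset.mem_union.1 h1 with h2 | h2
    · exact (hHv h2).1 rfl
    · exact (hXN v (hS h2)).ne rfl
  have hN : ∀ S ∈ X.powerset, G.neighborFinset v ∩ (H ∪ S) = S := by
    intro S hS
    have hS' : ∀ u ∈ S, G.Adj v u := fun u hu ↦ hXN u (Finset.mem_powerset.1 hS hu)
    ext u
    simp only [Finset.mem_inter, mem_neighborFinset, Finset.mem_union]
    grind
  have hinj : Set.InjOn (H ∪ ·) (X.powerset : Set (Finset V)) := by
    intro S hS T hT h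
    rw [← hN S hS, ← hN T hT]
    exact congrArg (G.neighborFinset v ∩ ·) h
  rw [Finset.card_insert_of_notMem hnot, Finset.sum_insert hnot, Finset.card_image_of_injOn hinj,
    Finset.sum_image hinj, Finset.card_powerset]
  have hsum : ∑ S ∈ X.powerset, #S ≤
      ∑ S ∈ X.powerset, ((if v ∈ H ∪ S then d else 0) + #(G.neighborFinset v ∩ (H ∪ S))) := by
    refine Finset.sum_le_sum fun S hS ↦ ?_
    rw [hN S hS]
    exact Nat.le_add_left _ _
  have h1 := two_mul_sum_powerset_card X
  have h2 := mul_two_pow_add_one_le (x := #X) hd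
  simp only [Finset.mem_insert_self, if_true]
  nlinarith

theorem card_indepSets_mul_le_sum (hG : G.CliqueFree 3) {L d : ℕ}
    (hd : L * (16 ^ L + 1) ≤ d) (v : V) :
    #(indepSets G) * L ≤
      ∑ W ∈ indepSets G, ((if v ∈ W then d else 0) + #(G.neighborFinset v ∩ W)) := by
  set f : Finset V → Finset V := fun W ↦ W \ insert v (G.neighborFinset v)
  have hf : ∀ W ∈ indepSets G, f W ∈ (indepSets G).image f := fun W ↦ Finset.mem_image_of_mem f
  rw [Finset.card_eq_sum_card_fiberwise hf, Finset.sum_mul,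
    ← Finset.sum_fiberwise_of_maps_to hf]
  refine Finset.sum_le_sum fun H hH ↦ ?_
  obtain ⟨W, hW, rfl⟩ := Finset.mem_image.1 hH
  refine card_filter_mul_le_sum_filter hG hd v ?_ Finset.sdiff_disjoint
  rw [mem_indepSets] at hW ⊢
  exact fun a ha b hb ↦ hW a (Finset.mem_sdiff.1 ha).1 b (Finset.mem_sdiff.1 hb).1

theorem sum_card_neighborFinset_inter (W : Finset V) :
    ∑ v, #(G.neighborFinset v ∩ W) = ∑ w ∈ W, G.degree w := by
  have h1 : ∀ v, #(G.neighborFinset v ∩ W) = ∑ w ∈ W, if G.Adj w v then 1 else 0 := by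
    intro v
    rw [← Finset.card_filter]
    congr 1
    ext w
    simp [and_comm, G.adj_comm]
  simp_rw [h1]
  rw [Finset.sum_comm]
  refine Finset.sum_congr rfl fun w _ ↦ ?_
  rw [← Finset.card_filter, ← card_neighborFinset_eq_degree]
  congr 1
  ext u
  simp

/-- A triangle-free graph on `N` vertices with maximum degree at most `d` has an independent set
of size at least `N * L / (2 * d)`, where `L` may be as large as a constant times `log d`. -/
theorem exists_isIndepSet_of_cliqueFree_three (hG : G.CliqueFree 3) {L d : ℕ}
    (hd : L * (16 ^ L + 1) ≤ d) (hdeg : ∀ v, G.degree v ≤ d) :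
    ∃ W : Finset V, G.IsIndepSet (W : Set V) ∧ Fintype.card V * L ≤ 2 * d * #W := by
  have hne : (indepSets G).Nonempty := ⟨∅, by simp [mem_indepSets]⟩
  have key : ∑ W ∈ indepSets G, Fintype.card V * L ≤ ∑ W ∈ indepSets G, 2 * d * #W := by
    calc ∑ W ∈ indepSets G, Fintype.card V * L = ∑ _v : V, #(indepSets G) * L := by
          simp only [Finset.sum_const, smul_eq_mul, Finset.card_univ]; ring
      _ ≤ ∑ v : V, ∑ W ∈ indepSets G,
            ((if v ∈ W then d else 0) + #(G.neighborFinset v ∩ W)) :=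
          Finset.sum_le_sum fun v _ ↦ card_indepSets_mul_le_sum hG hd v
      _ = ∑ W ∈ indepSets G, (#W * d + ∑ w ∈ W, G.degree w) := by
          rw [Finset.sum_comm]
          refine Finset.sum_congr rfl fun W _ ↦ ?_
          rw [Finset.sum_add_distrib, sum_card_neighborFinset_inter]
          simp
      _ ≤ ∑ W ∈ indepSets G, 2 * d * #W := by
          refine Finset.sum_le_sum fun W _ ↦ ?_
          have := Finset.sum_le_card_nsmul W _ d fun w _ ↦ hdeg w
          rw [smul_eq_mul] at this
          nlinarith
  obtain ⟨W, hW, h⟩ := Finset.exists_le_of_sum_le hne key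
  exact ⟨W, by simpa [indepSets] using hW, h⟩

end IndepSets

theorem exists_isNClique_of_lt {L n N : ℕ} (hn : L * (16 ^ L + 1) ≤ n)
    (hN : 2 * n ^ 2 < N * L) (G : SimpleGraph (Fin N)) :
    (∃ s, G.IsNClique 3 s) ∨ ∃ s, Gᶜ.IsNClique n s := by
  classical
  by_contra! h
  obtain ⟨h3, hn'⟩ := h
  have hsmall : ∀ W : Finset (Fin N), G.IsIndepSet (W : Set (Fin N)) → #W ≤ n := by
    intro W hW
    by_contra! hlt
    obtain ⟨T, hT, hTn⟩ := Finset.exists_subset_card_eq hlt.le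
    refine hn' T ((isNClique_compl G).2 ⟨hW.mono (Finset.coe_subset.2 hT), hTn⟩)
  have hdeg : ∀ v, G.degree v ≤ n := by
    intro v
    rw [← card_neighborFinset_eq_degree]
    refine hsmall _ ?_
    rw [coe_neighborFinset]
    exact G.isIndepSet_neighborSet_of_triangleFree h3 v
  obtain ⟨W, hW, hle⟩ := exists_isIndepSet_of_cliqueFree_three (G := G) h3 hn hdeg
  have := hsmall W hW
  rw [Fintype.card_fin] at hle
  nlinarith [Nat.mul_le_mul_left (2 * n) this]

theorem mul_sixteen_pow_add_one_le {n : ℕ} (hn : n ≠ 0) :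
    Nat.log 256 n * (16 ^ Nat.log 256 n + 1) ≤ n := by
  refine le_trans ?_ (Nat.pow_log_le_self 256 hn)
  generalize Nat.log 256 n = L
  have h1 : L + 1 ≤ 2 ^ L := Nat.lt_two_pow_self
  have h2 : 2 ^ L ≤ 16 ^ L := Nat.pow_le_pow_left (by norm_num) L
  have h3 : (256 : ℕ) ^ L = 16 ^ L * 16 ^ L := by rw [← mul_pow]; norm_num
  nlinarith [Nat.mul_le_mul_right (16 ^ L) (h1.trans h2)]

theorem ramsey_three_le {n : ℕ} (hn : 256 ≤ n) :
    ramsey 3 n ≤ 2 * n ^ 2 / Nat.log 256 n + 1 := by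
  have hL : 0 < Nat.log 256 n := Nat.log_pos (by norm_num) hn
  exact Nat.sInf_le ⟨Nat.succ_pos _,
    exists_isNClique_of_lt (mul_sixteen_pow_add_one_le (by omega))
      ((Nat.lt_mul_div_succ _ hL).trans_eq (mul_comm _ _))⟩

theorem ramsey_three_lt_succ {n : ℕ} (hn : 255 ≤ n) : ramsey 3 n < ramsey 3 (n + 1) := by
  have hmem : ramsey 3 (n + 1) ∈ {N : ℕ | 0 < N ∧ ∀ G : SimpleGraph (Fin N),
      (∃ s, G.IsNClique 3 s) ∨ ∃ s, Gᶜ.IsNClique (n + 1) s} := by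
    have hL : 0 < Nat.log 256 (n + 1) := Nat.log_pos (by norm_num) (by omega)
    exact Nat.sInf_mem ⟨_, Nat.succ_pos _,
      exists_isNClique_of_lt (mul_sixteen_pow_add_one_le (by omega))
        ((Nat.lt_mul_div_succ _ hL).trans_eq (mul_comm _ _))⟩
  obtain ⟨hpos, hcol⟩ := hmem
  obtain ⟨M, hM⟩ : ∃ M, ramsey 3 (n + 1) = M + 1 := ⟨_, (Nat.succ_pred_eq_of_pos hpos).symm⟩
  rw [hM] at hcol ⊢
  have hM0 : 0 < M := by
    rcases Nat.eq_zero_or_pos M with rfl | h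
    · rcases hcol ⊥ with ⟨s, hs⟩ | ⟨s, hs⟩
      · have := hs.card_eq ▸ s.card_le_univ
        simp at this
      · have := hs.card_eq ▸ s.card_le_univ
        simp at this
        omega
    · exact h
  refine Nat.lt_succ_of_le (Nat.sInf_le ⟨hM0, fun G ↦ ?_⟩)
  classical
  set e : Fin M ↪ Fin (M + 1) := Fin.castSuccEmb
  have hlast : ∀ a : Fin (M + 1), a = Fin.last M ∨ ∃ b, e b = a := fun a ↦ by
    rcases Fin.eq_castSucc_or_eq_last a with ⟨b, rfl⟩ | h
    · exact Or.inr ⟨b, rfl⟩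
    · exact Or.inl h
  have hpre : ∀ s : Finset (Fin (M + 1)), Fin.last M ∉ s →
      (s.preimage e e.injective.injOn).map e = s := fun s hs ↦ by
    ext a
    simp only [Finset.mem_map, Finset.mem_preimage]
    constructor
    · rintro ⟨b, hb, rfl⟩
      exact hb
    · intro ha
      rcases hlast a with rfl | ⟨b, rfl⟩
      · exact absurd ha hs
      · exact ⟨b, ha, rfl⟩
  rcases hcol (G.map e) with ⟨s, hs⟩ | ⟨s, hs⟩
  · left
    have hs' : Fin.last M ∉ s := fun hl ↦ by
      obtain ⟨b, hb, hne⟩ := s.exists_mem_ne (by rw [hs.card_eq]; norm_num) (Fin.last M)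
      obtain ⟨u, w, -, hu, -⟩ := (G.map_adj e _ _).1 (hs.isClique hl hb hne.symm)
      exact (Fin.castSucc_lt_last u).ne hu
    refine ⟨s.preimage e e.injective.injOn, fun a ha b hb hab ↦ ?_, ?_⟩
    · have := hs.isClique (Finset.mem_preimage.1 ha) (Finset.mem_preimage.1 hb)
        (e.injective.ne hab)
      exact (G.map_adj_apply).1 this
    · rw [← Finset.card_map e, hpre s hs', hs.card_eq]
  · right
    have hcard : n ≤ #(s.erase (Fin.last M)) := by
      have := Finset.pred_card_le_card_erase (s := s) (a := Fin.last M)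
      rw [hs.card_eq] at this
      omega
    obtain ⟨T, hT, hTn⟩ := Finset.exists_subset_card_eq hcard
    have hT' : Fin.last M ∉ T := fun h ↦ (Finset.mem_erase.1 (hT h)).1 rfl
    refine ⟨T.preimage e e.injective.injOn, fun a ha b hb hab ↦ ?_, ?_⟩
    · have hmem : ∀ c, e c ∈ T → e c ∈ s := fun c hc ↦ (Finset.mem_erase.1 (hT hc)).2
      have := hs.isClique (hmem a (Finset.mem_preimage.1 ha)) (hmem b (Finset.mem_preimage.1 hb))
        (e.injective.ne hab)
      rw [compl_adj] at this ⊢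
      exact ⟨hab, fun h ↦ this.2 ((G.map_adj_apply).2 h)⟩
    · rw [← Finset.card_map e, hpre T hT', hTn]

theorem ramsey_three_strictMonoOn : StrictMonoOn (ramsey 3) (Set.Ici 256) := by
  intro a ha b _ hab
  induction b, hab using Nat.le_induction with
  | base => exact ramsey_three_lt_succ (by have := Set.mem_Ici.1 ha; omega)
  | succ m hm ih =>
    have h256 := Set.mem_Ici.1 ha
    exact (ih (Set.mem_Ici.2 (by omega))).trans (ramsey_three_lt_succ (by omega))

theorem le_ramseyCount {x : ℝ} {M : ℕ} (hM : (ramsey 3 M : ℝ) ≤ x) :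
    M - 255 ≤ ramseyCount x := by
  rcases lt_or_ge M 256 with hlt | hge
  · omega
  have hfin : (RamseySet x).Finite :=
    (Set.finite_Iic ⌊x⌋₊).subset fun m hm ↦ Nat.le_floor hm.2
  have hcard : (Set.Icc 256 M).ncard = M - 255 := by
    rw [← Finset.coe_Icc, Set.ncard_coe_finset, Nat.card_Icc]; omega
  rw [← hcard]
  refine Set.ncard_le_ncard_of_injOn (ramsey 3) (fun n hn ↦ ⟨⟨3, n, le_rfl, ?_, rfl⟩, ?_⟩) ?_ hfin
  · have := hn.1; omega
  · refine le_trans (Nat.cast_le.2 ?_) hM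
    exact ramsey_three_strictMonoOn.monotoneOn hn.1 hge hn.2
  · exact ramsey_three_strictMonoOn.injOn.mono fun n hn ↦ hn.1

theorem log_le_mul_natLog {x : ℝ} {M : ℕ} (hx : 0 < x) (hM : 256 ≤ M) (hxM : x ≤ (M : ℝ) ^ 4) :
    Real.log x ≤ 45 * (Nat.log 256 M : ℝ) := by
  have hL : (1 : ℝ) ≤ Nat.log 256 M := by exact_mod_cast Nat.log_pos (by norm_num) hM
  have h1 : (M : ℝ) ≤ 256 ^ (Nat.log 256 M + 1) := by
    exact_mod_cast (Nat.lt_pow_succ_log_self (by norm_num) M).le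
  have hM0 : (0 : ℝ) < M := by exact_mod_cast (by omega : 0 < M)
  have h256 : Real.log 256 = 8 * Real.log 2 := by
    rw [show (256 : ℝ) = 2 ^ 8 by norm_num, Real.log_pow]; norm_num
  have h2 := Real.log_two_lt_d9
  have h3 : Real.log x ≤ 4 * Real.log M := by
    have := Real.log_le_log hx hxM
    rwa [Real.log_pow] at this
  have h4 := Real.log_le_log hM0 h1
  rw [Real.log_pow, h256] at h4
  push_cast at h4
  nlinarith

/-- lower bound `r(x) ≥ a √(x ln x)`. -/
theorem ramseyCount_lower_bound :
    ∃ a x₀ : ℝ, 0 < a ∧ 0 < x₀ ∧ ∀ x : ℝ, x₀ ≤ x →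
      a * Real.sqrt (x * Real.log x) ≤ (ramseyCount x : ℝ) := by
  refine ⟨1 / 40, 10 ^ 10, by norm_num, by norm_num, fun x hx ↦ ?_⟩
  have hx0 : 0 < x := lt_of_lt_of_le (by norm_num) hx
  have hlog : 1 ≤ Real.log x := by
    rw [Real.le_log_iff_exp_le hx0]
    linarith [Real.exp_one_lt_d9]
  set t := Real.sqrt (x * Real.log x)
  have ht2 : t ^ 2 = x * Real.log x := Real.sq_sqrt (by positivity)
  have ht0 : 0 ≤ t := Real.sqrt_nonneg _
  have hxt : x ≤ t ^ 2 := by rw [ht2]; nlinarith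
  have ht5 : 10 ^ 5 ≤ t := by
    refine Real.le_sqrt_of_sq_le ?_
    rw [← ht2]; linarith
  set M := ⌊t / 20⌋₊
  have hM1 : (M : ℝ) ≤ t / 20 := Nat.floor_le (by positivity)
  have hM2 : t / 20 < M + 1 := Nat.lt_floor_add_one _
  have hM256 : 256 ≤ M := Nat.le_floor (by push_cast; linarith)
  have hMx : x ≤ (M : ℝ) ^ 4 := by
    have h1 : t / 40 ≤ M := by linarith
    have h2 : t ≤ (M : ℝ) ^ 2 := by nlinarith
    calc x ≤ t ^ 2 := hxt
      _ ≤ ((M : ℝ) ^ 2) ^ 2 := pow_le_pow_left₀ ht0 h2 2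
      _ = (M : ℝ) ^ 4 := by ring
  have hL := log_le_mul_natLog hx0 hM256 hMx
  have hL0 : (0 : ℝ) < Nat.log 256 M := by linarith
  have hram : (ramsey 3 M : ℝ) ≤ x := by
    have h1 : (ramsey 3 M : ℝ) ≤ (2 * M ^ 2 / Nat.log 256 M : ℕ) + 1 := by
      exact_mod_cast ramsey_three_le hM256
    have h2 : ((2 * M ^ 2 / Nat.log 256 M : ℕ) : ℝ) ≤ 2 * (M : ℝ) ^ 2 / Nat.log 256 M := by
      exact_mod_cast Nat.cast_div_le (α := ℝ) (m := 2 * M ^ 2) (n := Nat.log 256 M)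
    have h3 : 2 * (M : ℝ) ^ 2 / Nat.log 256 M ≤ x / 4 := by
      rw [div_le_iff₀ hL0]
      have h4 : (M : ℝ) ^ 2 ≤ (t / 20) ^ 2 := pow_le_pow_left₀ (by positivity) hM1 2
      nlinarith [mul_le_mul_of_nonneg_left hL hx0.le]
    linarith
  have hcount : (M : ℝ) ≤ ramseyCount x + 255 := by
    exact_mod_cast Nat.sub_le_iff_le_add.1 (le_ramseyCount hram)
  linarith
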